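/- Let b > 0, β ∈ (0,1), and let ω_b(t) = 2^b e^{-2}|log t|^{-b} for t ∈ (0, e^{-2}), ω_b(t) = e^{-2} for t ≥ e^{-2}. Then for every t ∈ (0, β e^{-2}), one has ω_b(t/β) ≤ |log(e β^{-1/2})|^b · ω_b(t). -/

import Mathlib

/-- The logarithmic modulus of continuity `ω_b`. -/
noncomputable def omegaB (b t : ℝ) : ℝ :=
  if t < Real.exp (-2) then (2:ℝ) ^ b * Real.exp (-2) * |Real.log t| ^ (-b)
  else Real.exp (-2)

/-- For `b > 0`, `β ∈ (0,1)` and `t ∈ (0, β e⁻²)`,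
`ω_b(t/β) ≤ |log(e β^{-1/2})|^b · ω_b(t)`. -/
theorem stmt_3 (b β : ℝ) (hb : 0 < b) (hβ : β ∈ Set.Ioo (0:ℝ) 1) :
    ∀ t : ℝ, t ∈ Set.Ioo 0 (β * Real.exp (-2)) →
      omegaB b (t / β) ≤
        |Real.log (Real.exp 1 * β ^ (-(1:ℝ)/2))| ^ b * omegaB b t := by
  obtain ⟨h0, h1⟩ := hβ
  intro t ht
  obtain ⟨ht0, ht1⟩ := ht
  have hE := Real.exp_pos (-2)
  have hd : t / β < Real.exp (-2) := by
    rw [div_lt_iff₀ h0]; linarith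
  have ht2 : t < Real.exp (-2) := by nlinarith
  have hl : Real.log β < 0 := Real.log_neg h0 h1
  have hlog : Real.log (t / β) < -2 := by
    have := Real.log_lt_log (div_pos ht0 h0) hd
    rwa [Real.log_exp] at this
  rw [Real.log_div ht0.ne' h0.ne'] at hlog
  have hfac : Real.log (Real.exp 1 * β ^ (-(1:ℝ)/2)) = 1 - Real.log β / 2 := by
    rw [Real.log_mul (Real.exp_pos 1).ne' (Real.rpow_pos_of_pos h0 _).ne', Real.log_exp,
      Real.log_rpow h0]
    ring
  unfold omegaB
  rw [if_pos hd, if_pos ht2, hfac, Real.log_div ht0.ne' h0.ne']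
  generalize Real.log β = l at *
  generalize Real.log t = L at *
  rw [abs_of_neg (by linarith : L - l < 0), abs_of_neg (by linarith : L < 0),
    abs_of_pos (by linarith : 0 < 1 - l / 2)]
  have hA : 0 < -(L - l) := by linarith
  have hL : 0 < -L := by linarith
  have hF : 0 < 1 - l / 2 := by linarith
  have key : (-(L - l)) ^ (-b) ≤ (1 - l / 2) ^ b * (-L) ^ (-b) := by
    rw [Real.rpow_neg hA.le, Real.rpow_neg hL.le, ← div_eq_mul_inv, inv_eq_one_div,
      div_le_div_iff₀ (Real.rpow_pos_of_pos hA _) (Real.rpow_pos_of_pos hL _), one_mul,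
      ← Real.mul_rpow hF.le hA.le]
    apply Real.rpow_le_rpow hL.le _ hb.le
    nlinarith
  have hc : 0 ≤ (2:ℝ) ^ b * Real.exp (-2) := by positivity
  calc _ ≤ (2:ℝ) ^ b * Real.exp (-2) * ((1 - l / 2) ^ b * (-L) ^ (-b)) :=
        mul_le_mul_of_nonneg_left key hc
    _ = _ := by ring
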